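/- Let r(x) = e^{x²/2} ∫_x^∞ e^{−t²/2} dt be Mill's ratio. Then: (a) on (0,∞), the function x ↦ r(x) is decreasing, the function x ↦ x·r(x) is increasing, and for every α ∈ (0,1) there exists x* > 0 such that x ↦ x^α r(x) is increasing on (0,x*] and decreasing on [x*,∞); (b) on (0,∞), the function x ↦ r'(x) is increasing, the function x ↦ x² r'(x) is decreasing, and for every α ∈ (0,2) there exists x* > 0 such that x ↦ x^α r'(x) is decreasing on (0,x*] and increasing on [x*,∞). -/

import Mathlib

open MeasureTheory Set

/-- Mill's ratio of the Gaussian law. -/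
noncomputable def mill (x : ℝ) : ℝ :=
  Real.exp (x ^ 2 / 2) * ∫ t in Ioi x, Real.exp (-t ^ 2 / 2)

open Filter Topology

/-- A strictly decreasing function vanishing at infinity is positive. -/
lemma pos_of_hasDerivAt_neg_of_tendsto_zero {F F' : ℝ → ℝ}
    (hF : ∀ x, HasDerivAt F (F' x) x) (hF' : ∀ x, F' x < 0)
    (hlim : Tendsto F atTop (𝓝 0)) (x : ℝ) : 0 < F x := by
  have hanti : StrictAnti F := strictAnti_of_hasDerivAt_neg hF hF'
  have h1 : 0 ≤ F (x + 1) := hanti.antitone.le_of_tendsto hlim (x + 1)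
  exact h1.trans_lt (hanti (by linarith))

section Tail

/-- The unnormalized Gaussian tail. -/
noncomputable def gaussTail (x : ℝ) : ℝ := ∫ t in Ioi x, Real.exp (-t ^ 2 / 2)

lemma integrable_exp_neg_sq_half : Integrable fun t : ℝ => Real.exp (-t ^ 2 / 2) := by
  convert integrable_exp_neg_mul_sq (b := 1 / 2) (by norm_num) using 3
  ring

lemma hasDerivAt_exp_neg_sq_half (x : ℝ) :
    HasDerivAt (fun t : ℝ => Real.exp (-t ^ 2 / 2)) (-x * Real.exp (-x ^ 2 / 2)) x := by
  have h := (((hasDerivAt_pow 2 x).neg).div_const 2).exp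
  refine h.congr_deriv ?_
  simp
  ring

lemma gaussTail_eq (x : ℝ) :
    gaussTail x = gaussTail 0 - ∫ t in (0 : ℝ)..x, Real.exp (-t ^ 2 / 2) := by
  have h := intervalIntegral.integral_interval_add_Ioi
    (integrable_exp_neg_sq_half.integrableOn (s := Ioi 0))
    (integrable_exp_neg_sq_half.integrableOn (s := Ioi x))
  unfold gaussTail
  linarith

lemma hasDerivAt_gaussTail (x : ℝ) :
    HasDerivAt gaussTail (-Real.exp (-x ^ 2 / 2)) x := by
  have hc : Continuous fun t : ℝ => Real.exp (-t ^ 2 / 2) := by fun_prop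
  have h := (hc.integral_hasStrictDerivAt 0 x).hasDerivAt.const_sub (gaussTail 0)
  exact h.congr_of_eventuallyEq (Eventually.of_forall gaussTail_eq)

lemma tendsto_gaussTail : Tendsto gaussTail atTop (𝓝 0) := by
  have h := (intervalIntegral_tendsto_integral_Ioi 0
    (integrable_exp_neg_sq_half.integrableOn (s := Ioi 0)) tendsto_id).const_sub (gaussTail 0)
  have h0 : gaussTail 0 - ∫ t in Ioi (0 : ℝ), Real.exp (-t ^ 2 / 2) = 0 := sub_self _
  rw [h0] at h
  exact h.congr fun x => (gaussTail_eq x).symm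

lemma gaussTail_pos (x : ℝ) : 0 < gaussTail x :=
  pos_of_hasDerivAt_neg_of_tendsto_zero hasDerivAt_gaussTail
    (fun _ => neg_lt_zero.2 (Real.exp_pos _)) tendsto_gaussTail x

lemma tendsto_pow_mul_exp_neg_sq_half (k : ℕ) :
    Tendsto (fun x : ℝ => x ^ k * Real.exp (-x ^ 2 / 2)) atTop (𝓝 0) := by
  refine tendsto_of_tendsto_of_tendsto_of_le_of_le' tendsto_const_nhds
    (Real.tendsto_pow_mul_exp_neg_atTop_nhds_zero k) ?_ ?_
  · filter_upwards [eventually_ge_atTop 0] with x hx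
    positivity
  · filter_upwards [eventually_ge_atTop 2] with x hx
    have : Real.exp (-x ^ 2 / 2) ≤ Real.exp (-x) := Real.exp_le_exp.2 (by nlinarith)
    gcongr

lemma gaussTail_le_exp {x : ℝ} (hx : 1 ≤ x) : gaussTail x ≤ Real.exp (-x ^ 2 / 2) := by
  have hd (y : ℝ) := (hasDerivAt_exp_neg_sq_half y).sub (hasDerivAt_gaussTail y)
  have hanti : AntitoneOn (fun y => Real.exp (-y ^ 2 / 2) - gaussTail y) (Ici 1) := by
    refine antitoneOn_of_hasDerivWithinAt_nonpos (convex_Ici 1)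
      (fun y _ => (hd y).continuousAt.continuousWithinAt)
      (fun y _ => (hd y).hasDerivWithinAt) fun y hy => ?_
    rw [interior_Ici, mem_Ioi] at hy
    nlinarith [Real.exp_pos (-y ^ 2 / 2)]
  have hlim : Tendsto (fun y => Real.exp (-y ^ 2 / 2) - gaussTail y) atTop (𝓝 0) := by
    simpa using (tendsto_pow_mul_exp_neg_sq_half 0).sub tendsto_gaussTail
  refine sub_nonneg.1 (le_of_tendsto hlim ?_)
  filter_upwards [eventually_ge_atTop x] with y hy
  exact hanti hx (hx.trans hy) hy

lemma tendsto_pow_mul_gaussTail (k : ℕ) :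
    Tendsto (fun x : ℝ => x ^ k * gaussTail x) atTop (𝓝 0) := by
  refine tendsto_of_tendsto_of_tendsto_of_le_of_le' tendsto_const_nhds
    (tendsto_pow_mul_exp_neg_sq_half k) ?_ ?_
  · filter_upwards [eventually_ge_atTop 0] with x hx
    have := gaussTail_pos x
    positivity
  · filter_upwards [eventually_ge_atTop 1] with x hx
    have := gaussTail_le_exp hx
    gcongr

lemma mul_gaussTail_lt_exp (x : ℝ) : 0 < Real.exp (-x ^ 2 / 2) - x * gaussTail x := by
  refine pos_of_hasDerivAt_neg_of_tendsto_zero (F' := fun x => -gaussTail x)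
    (F := fun x => Real.exp (-x ^ 2 / 2) - x * gaussTail x)
    (fun x => ?_) (fun x => neg_lt_zero.2 (gaussTail_pos x)) ?_ x
  · refine ((hasDerivAt_exp_neg_sq_half x).sub
      ((hasDerivAt_id x).mul (hasDerivAt_gaussTail x))).congr_deriv ?_
    simp
  · simpa using (tendsto_pow_mul_exp_neg_sq_half 0).sub (tendsto_pow_mul_gaussTail 1)

lemma mul_exp_lt_mul_gaussTail (x : ℝ) :
    0 < (1 + x ^ 2) * gaussTail x - x * Real.exp (-x ^ 2 / 2) := by
  refine pos_of_hasDerivAt_neg_of_tendsto_zero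
    (F' := fun x => -(2 * (Real.exp (-x ^ 2 / 2) - x * gaussTail x)))
    (F := fun x => (1 + x ^ 2) * gaussTail x - x * Real.exp (-x ^ 2 / 2))
    (fun x => ?_) (fun x => by linarith [mul_gaussTail_lt_exp x]) ?_ x
  · refine ((((hasDerivAt_pow 2 x).const_add 1).mul (hasDerivAt_gaussTail x)).sub
      ((hasDerivAt_id x).mul (hasDerivAt_exp_neg_sq_half x))).congr_deriv ?_
    simp
    ring
  · have h := (tendsto_gaussTail.add (tendsto_pow_mul_gaussTail 2)).sub
      (tendsto_pow_mul_exp_neg_sq_half 1)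
    simp only [add_zero, sub_zero] at h
    exact h.congr fun x => by ring

lemma mul_gaussTail_lt_mul_exp (x : ℝ) :
    0 < (2 + x ^ 2) * Real.exp (-x ^ 2 / 2) - (3 * x + x ^ 3) * gaussTail x := by
  refine pos_of_hasDerivAt_neg_of_tendsto_zero
    (F' := fun x => -(3 * ((1 + x ^ 2) * gaussTail x - x * Real.exp (-x ^ 2 / 2))))
    (F := fun x => (2 + x ^ 2) * Real.exp (-x ^ 2 / 2) - (3 * x + x ^ 3) * gaussTail x)
    (fun x => ?_) (fun x => by linarith [mul_exp_lt_mul_gaussTail x]) ?_ x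
  · refine ((((hasDerivAt_pow 2 x).const_add 2).mul (hasDerivAt_exp_neg_sq_half x)).sub
      ((((hasDerivAt_id x).const_mul 3).add (hasDerivAt_pow 3 x)).mul
        (hasDerivAt_gaussTail x))).congr_deriv ?_
    simp
    ring
  · have h := (((tendsto_pow_mul_exp_neg_sq_half 0).const_mul 2).add
      (tendsto_pow_mul_exp_neg_sq_half 2)).sub
      (((tendsto_pow_mul_gaussTail 1).const_mul 3).add (tendsto_pow_mul_gaussTail 3))
    simp only [mul_zero, add_zero, sub_zero] at h
    exact h.congr fun x => by ring

end Tail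

section Mill

lemma mill_eq (x : ℝ) : mill x = Real.exp (x ^ 2 / 2) * gaussTail x := rfl

lemma exp_sq_half_mul_exp_neg (x : ℝ) :
    Real.exp (x ^ 2 / 2) * Real.exp (-x ^ 2 / 2) = 1 := by
  rw [← Real.exp_add]
  ring_nf
  exact Real.exp_zero

lemma mill_pos (x : ℝ) : 0 < mill x := mul_pos (Real.exp_pos _) (gaussTail_pos x)

lemma hasDerivAt_mill (x : ℝ) : HasDerivAt mill (-(1 - x * mill x)) x := by
  have h := (((hasDerivAt_pow 2 x).div_const 2).exp).mul (hasDerivAt_gaussTail x)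
  refine HasDerivAt.congr_deriv (f := mill) h ?_
  have := exp_sq_half_mul_exp_neg x
  rw [mill_eq]
  simp
  linear_combination -this

lemma deriv_mill : deriv mill = fun x => -(1 - x * mill x) :=
  funext fun x => (hasDerivAt_mill x).deriv

lemma hasDerivAt_one_sub_mul_mill (x : ℝ) :
    HasDerivAt (fun y => 1 - y * mill y) (-(mill x - x * (1 - x * mill x))) x := by
  refine (((hasDerivAt_id x).mul (hasDerivAt_mill x)).const_sub 1).congr_deriv ?_
  simp
  ring

lemma hasDerivAt_mill_sub (x : ℝ) :
    HasDerivAt (fun y => mill y - y * (1 - y * mill y))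
      (x * (mill x - x * (1 - x * mill x)) - 2 * (1 - x * mill x)) x := by
  refine ((hasDerivAt_mill x).sub
    ((hasDerivAt_id x).mul (hasDerivAt_one_sub_mul_mill x))).congr_deriv ?_
  simp
  ring

lemma one_sub_mul_mill_pos (x : ℝ) : 0 < 1 - x * mill x := by
  have h := mul_pos (Real.exp_pos (x ^ 2 / 2)) (mul_gaussTail_lt_exp x)
  have h1 := exp_sq_half_mul_exp_neg x
  rw [mill_eq]
  linear_combination h + h1

lemma mul_one_sub_mul_mill_lt (x : ℝ) : x * (1 - x * mill x) < mill x := by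
  have h := mul_pos (Real.exp_pos (x ^ 2 / 2)) (mul_exp_lt_mul_gaussTail x)
  have h1 := exp_sq_half_mul_exp_neg x
  rw [mill_eq]
  linear_combination h - x * h1

lemma mul_mill_sub_lt (x : ℝ) :
    x * (mill x - x * (1 - x * mill x)) < 2 * (1 - x * mill x) := by
  have h := mul_pos (Real.exp_pos (x ^ 2 / 2)) (mul_gaussTail_lt_mul_exp x)
  have h1 := exp_sq_half_mul_exp_neg x
  rw [mill_eq]
  linear_combination h + (2 + x ^ 2) * h1

end Mill

section Riccati

/-- A bounded solution `0 < w < c` of `x w' = w² + (1 + x²) w - c x²` has positive derivative. -/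
lemma riccati_pos {c : ℝ} {w : ℝ → ℝ}
    (hw : ∀ x, 0 < x → HasDerivAt w ((w x ^ 2 + w x * (1 + x ^ 2) - c * x ^ 2) / x) x)
    (h0 : ∀ x, 0 < x → 0 < w x) (hc : ∀ x, 0 < x → w x < c) {a : ℝ} (ha : 0 < a) :
    0 < w a ^ 2 + w a * (1 + a ^ 2) - c * a ^ 2 := by
  by_contra! hQa
  have hcpos : 0 < c := (h0 a ha).trans (hc a ha)
  let Q : ℝ → ℝ := fun x => w x ^ 2 + w x * (1 + x ^ 2) - c * x ^ 2
  have hQ (x : ℝ) (hx : 0 < x) :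
      HasDerivAt Q (Q x / x * (2 * w x + 1 + x ^ 2) - 2 * x * (c - w x)) x := by
    refine ((((hw x hx).pow 2).add ((hw x hx).mul ((hasDerivAt_pow 2 x).const_add 1))).sub
      ((hasDerivAt_pow 2 x).const_mul c)).congr_deriv ?_
    simp [Q]
    ring
  -- `Q` is decreasing at each of its zeros, hence stays nonpositive.
  have hQneg (x : ℝ) (hx : a ≤ x) : Q x ≤ 0 := by
    refine image_le_of_deriv_right_lt_deriv_boundary (a := a) (b := x) (B := fun _ => 0)
      (B' := fun _ => 0) (fun y hy => (hQ y (ha.trans_le hy.1)).continuousAt.continuousWithinAt)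
      (fun y hy => (hQ y (ha.trans_le hy.1)).hasDerivWithinAt) hQa
      (fun y => hasDerivAt_const y 0) (fun y hy hy0 => ?_) ⟨hx, le_rfl⟩
    have hy' := ha.trans_le hy.1
    rw [hy0]
    have := mul_pos hy' (sub_pos.2 (hc y hy'))
    simp only [zero_div, zero_mul]
    linarith
  have hanti : AntitoneOn w (Ici a) := by
    refine antitoneOn_of_hasDerivWithinAt_nonpos (convex_Ici a)
      (fun y hy => (hw y (ha.trans_le hy)).continuousAt.continuousWithinAt)
      (f' := fun y => Q y / y)
      (fun y hy => (hw y (ha.trans_le (interior_subset hy))).hasDerivWithinAt) fun y hy => ?_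
    have hy' : a ≤ y := interior_subset hy
    exact div_nonpos_of_nonpos_of_nonneg (hQneg y hy') (ha.trans_le hy').le
  -- Eventually `w' ≤ -1`, which contradicts `0 < w`.
  have hδ : 0 < c - w a := sub_pos.2 (hc a ha)
  obtain ⟨b, hb⟩ : ∃ b, a ≤ b ∧ 1 ≤ b ∧ (c ^ 2 + c + 1) / (c - w a) ≤ b :=
    ⟨max a (max 1 ((c ^ 2 + c + 1) / (c - w a))), by simp⟩
  obtain ⟨hab, h1b, hbδ⟩ := hb
  have hslope (y : ℝ) (hy : b ≤ y) : Q y / y ≤ -1 := by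
    have hy0 : 0 < y := by linarith
    have h1 : c ^ 2 + c + 1 ≤ y * (c - w a) := (div_le_iff₀ hδ).1 (hbδ.trans hy)
    have h2 : w y ≤ w a := hanti self_mem_Ici (hab.trans hy) (hab.trans hy)
    have h3 := h0 y hy0
    have h4 := hc y hy0
    have h5 : w y ^ 2 ≤ c ^ 2 := by gcongr
    have h6 : y * (c ^ 2 + c + 1) ≤ y * (y * (c - w a)) := by gcongr
    have h7 : y ^ 2 * (c - w a) ≤ y ^ 2 * (c - w y) := by gcongr
    have h8 : c ^ 2 + c ≤ y * (c ^ 2 + c) := le_mul_of_one_le_left (by positivity) (h1b.trans hy)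
    rw [div_le_iff₀ hy0]
    simp only [Q]
    linarith
  have hanti' : AntitoneOn (fun y => w y + y) (Ici b) := by
    have hd (y : ℝ) (hy : b ≤ y) : HasDerivAt (fun y => w y + y) (Q y / y + 1) y :=
      (hw y (by linarith)).add (hasDerivAt_id y)
    refine antitoneOn_of_hasDerivWithinAt_nonpos (convex_Ici b)
      (fun y hy => (hd y hy).continuousAt.continuousWithinAt)
      (fun y hy => (hd y (interior_subset hy)).hasDerivWithinAt) fun y hy => ?_
    linarith [hslope y (interior_subset hy)]
  have hle : w (b + c) + (b + c) ≤ w b + b :=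
    hanti' self_mem_Ici (mem_Ici.2 (by linarith)) (by linarith)
  linarith [h0 (b + c) (by linarith), hc b (by linarith)]

/-- A bounded solution `0 < w < c` of `x w' = w² + (1 + x²) w - c x²` comes close to `c`. -/
lemma exists_lt_of_riccati {c : ℝ} {w : ℝ → ℝ}
    (hw : ∀ x, 0 < x → HasDerivAt w ((w x ^ 2 + w x * (1 + x ^ 2) - c * x ^ 2) / x) x)
    (h0 : ∀ x, 0 < x → 0 < w x) (hc : ∀ x, 0 < x → w x < c) {α : ℝ} (hα : α < c) :
    ∃ x, 0 < x ∧ α < w x := by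
  by_contra! h
  have hcpos : 0 < c := (h0 1 one_pos).trans (hc 1 one_pos)
  have hδ : 0 < c - α := sub_pos.2 hα
  obtain ⟨b, h1b, hbδ⟩ : ∃ b, 1 ≤ b ∧ (c ^ 2 + c) / (c - α) ≤ b :=
    ⟨max 1 ((c ^ 2 + c) / (c - α)), by simp⟩
  have hb0 : 0 < b := by linarith
  have h1 : c ^ 2 + c ≤ b * (c - α) := (div_le_iff₀ hδ).1 hbδ
  have h2 := h b hb0
  have h3 := h0 b hb0
  have h4 := hc b hb0
  have h5 : w b ^ 2 ≤ c ^ 2 := by gcongr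
  have h6 : b * (c - α) ≤ b * (b * (c - α)) := le_mul_of_one_le_left (by positivity) h1b
  have h7 : b ^ 2 * (c - α) ≤ b ^ 2 * (c - w b) := by gcongr
  linarith [riccati_pos hw h0 hc hb0]

/-- If `f' = -g` and `g' = x g - c f` with `f, g > 0` and `x g < c f`, then `x ^ α * f x` is
unimodal on `(0, ∞)` for every `0 < α < c`. -/
lemma exists_unimodal_rpow_mul {c : ℝ} {f g : ℝ → ℝ}
    (hf : ∀ x, HasDerivAt f (-g x) x) (hg : ∀ x, HasDerivAt g (x * g x - c * f x) x)
    (f0 : ∀ x, 0 < f x) (g0 : ∀ x, 0 < g x) (hfg : ∀ x, x * g x < c * f x)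
    {α : ℝ} (hα0 : 0 < α) (hαc : α < c) :
    ∃ x₀ : ℝ, 0 < x₀ ∧ StrictMonoOn (fun x => x ^ α * f x) (Ioc (0 : ℝ) x₀) ∧
      StrictAntiOn (fun x => x ^ α * f x) (Ici x₀) := by
  let w : ℝ → ℝ := fun x => x * g x / f x
  have hw (x : ℝ) (hx : 0 < x) :
      HasDerivAt w ((w x ^ 2 + w x * (1 + x ^ 2) - c * x ^ 2) / x) x := by
    have hfx := (f0 x).ne'
    refine (((hasDerivAt_id x).mul (hg x)).div (hf x) hfx).congr_deriv ?_
    simp only [w, id, Pi.mul_apply]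
    field_simp
    ring
  have hw0 (x : ℝ) (hx : 0 < x) : 0 < w x := div_pos (mul_pos hx (g0 x)) (f0 x)
  have hwc (x : ℝ) (_ : 0 < x) : w x < c := (div_lt_iff₀ (f0 x)).2 (hfg x)
  have hwcont : Continuous w :=
    (continuous_id.mul (continuous_iff_continuousAt.2 fun x => (hg x).continuousAt)).div
      (continuous_iff_continuousAt.2 fun x => (hf x).continuousAt) fun x => (f0 x).ne'
  have hmono : StrictMonoOn w (Ici 0) := by
    refine strictMonoOn_of_hasDerivWithinAt_pos (convex_Ici 0) hwcont.continuousOn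
      (f' := fun x => (w x ^ 2 + w x * (1 + x ^ 2) - c * x ^ 2) / x)
      (fun x hx => ?_) fun x hx => ?_
    all_goals rw [interior_Ici, mem_Ioi] at hx
    · exact (hw x hx).hasDerivWithinAt
    · exact div_pos (riccati_pos hw hw0 hwc hx) hx
  obtain ⟨b, hb, hαb⟩ := exists_lt_of_riccati hw hw0 hwc hαc
  obtain ⟨x₀, hx₀, hwx₀⟩ : α ∈ w '' Ioo 0 b :=
    intermediate_value_Ioo hb.le hwcont.continuousOn ⟨by simpa [w] using hα0, hαb⟩
  have hd (x : ℝ) (hx : 0 < x) :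
      HasDerivAt (fun x => x ^ α * f x) (x ^ (α - 1) * f x * (α - w x)) x := by
    have hfx := (f0 x).ne'
    refine ((Real.hasDerivAt_rpow_const (Or.inl hx.ne')).mul (hf x)).congr_deriv ?_
    rw [Real.rpow_sub_one hx.ne']
    simp only [w]
    field_simp
    ring
  have hpos (x : ℝ) (hx : 0 < x) : 0 < x ^ (α - 1) * f x :=
    mul_pos (Real.rpow_pos_of_pos hx _) (f0 x)
  refine ⟨x₀, hx₀.1, ?_, ?_⟩
  · refine strictMonoOn_of_hasDerivWithinAt_pos (convex_Ioc 0 x₀)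
      (fun x hx => (hd x hx.1).continuousAt.continuousWithinAt)
      (fun x hx => (hd x (interior_subset hx).1).hasDerivWithinAt) fun x hx => ?_
    rw [interior_Ioc] at hx
    refine mul_pos (hpos x hx.1) (sub_pos.2 ?_)
    rw [← hwx₀]
    exact hmono hx.1.le hx₀.1.le hx.2
  · refine strictAntiOn_of_hasDerivWithinAt_neg (convex_Ici x₀)
      (fun x hx => (hd x (hx₀.1.trans_le hx)).continuousAt.continuousWithinAt)
      (fun x hx => (hd x (hx₀.1.trans_le (interior_subset hx))).hasDerivWithinAt) fun x hx => ?_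
    rw [interior_Ici, mem_Ioi] at hx
    have hx0 := hx₀.1.trans hx
    refine mul_neg_of_pos_of_neg (hpos x hx0) (sub_neg.2 ?_)
    rw [← hwx₀]
    exact hmono hx₀.1.le hx0.le hx

end Riccati

/-- Proposition: monotonicity properties of `x^α r(x)` and `x^α r'(x)` on `(0,∞)`,
where `r` is Mill's ratio. -/
theorem mill_monotonicity :
    (StrictAntiOn mill (Ioi (0 : ℝ)) ∧
     StrictMonoOn (fun x => x * mill x) (Ioi (0 : ℝ)) ∧
     (∀ α : ℝ, 0 < α → α < 1 → ∃ x₀ : ℝ, 0 < x₀ ∧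
        StrictMonoOn (fun x => x ^ α * mill x) (Ioc (0 : ℝ) x₀) ∧
        StrictAntiOn (fun x => x ^ α * mill x) (Ici x₀))) ∧
    (StrictMonoOn (deriv mill) (Ioi (0 : ℝ)) ∧
     StrictAntiOn (fun x => x ^ 2 * deriv mill x) (Ioi (0 : ℝ)) ∧
     (∀ α : ℝ, 0 < α → α < 2 → ∃ x₀ : ℝ, 0 < x₀ ∧
        StrictAntiOn (fun x => x ^ α * deriv mill x) (Ioc (0 : ℝ) x₀) ∧
        StrictMonoOn (fun x => x ^ α * deriv mill x) (Ici x₀))) := by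
  have hm (x : ℝ) : HasDerivAt (fun y => y * mill y) (mill x - x * (1 - x * mill x)) x :=
    ((hasDerivAt_id x).mul (hasDerivAt_mill x)).congr_deriv (by simp; ring)
  have hsq (x : ℝ) : HasDerivAt (fun y => y ^ 2 * -(1 - y * mill y))
      (-(x * (2 * (1 - x * mill x) - x * (mill x - x * (1 - x * mill x))))) x :=
    ((hasDerivAt_pow 2 x).mul (hasDerivAt_one_sub_mul_mill x).neg).congr_deriv (by simp; ring)
  rw [deriv_mill]
  refine ⟨⟨?_, ?_, fun α h0 h1 => ?_⟩, ?_, ?_, fun α h0 h2 => ?_⟩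
  · exact (strictAnti_of_hasDerivAt_neg hasDerivAt_mill
      fun x => neg_lt_zero.2 (one_sub_mul_mill_pos x)).strictAntiOn _
  · exact (strictMono_of_hasDerivAt_pos hm
      fun x => sub_pos.2 (mul_one_sub_mul_mill_lt x)).strictMonoOn _
  · refine exists_unimodal_rpow_mul hasDerivAt_mill (c := 1) (fun x => ?_) mill_pos
      one_sub_mul_mill_pos (fun x => ?_) h0 h1
    · exact (hasDerivAt_one_sub_mul_mill x).congr_deriv (by ring)
    · simpa using mul_one_sub_mul_mill_lt x
  · exact (strictAnti_of_hasDerivAt_neg hasDerivAt_one_sub_mul_mill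
      fun x => neg_lt_zero.2 (sub_pos.2 (mul_one_sub_mul_mill_lt x))).neg.strictMonoOn _
  · refine strictAntiOn_of_hasDerivWithinAt_neg (convex_Ioi 0)
      (fun x _ => (hsq x).continuousAt.continuousWithinAt)
      (fun x _ => (hsq x).hasDerivWithinAt) fun x hx => ?_
    exact neg_lt_zero.2 (mul_pos (interior_subset hx) (sub_pos.2 (mul_mill_sub_lt x)))
  · obtain ⟨x₀, hx₀, hmono, hanti⟩ := exists_unimodal_rpow_mul hasDerivAt_one_sub_mul_mill
      hasDerivAt_mill_sub one_sub_mul_mill_pos (fun x => sub_pos.2 (mul_one_sub_mul_mill_lt x))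
      mul_mill_sub_lt h0 h2
    refine ⟨x₀, hx₀, ?_, ?_⟩
    · simpa only [mul_neg] using hmono.neg
    · simpa only [mul_neg] using hanti.neg
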